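/- Fix θ0 ∈ (1, 2) and δ > 0 with θ0 + δ < 2. Define, for entrywise positive u ∈ ℝ^n, Θ*(u) = sup{ ω ∈ [1, 2] : φ_ω(min_i u_i) ≥ 0 } and Θ(u) = min(max(1, Θ*(u) − δ), θ0). Then there exists ε > 0 such that for every entrywise positive vector u ∈ ℝ^n with |u_i − 1| < ε for all i, one has Θ(u) = θ0. -/

import Mathlib

/-- `φ_ω(x) = x(1 - x^{-ω}) - ω log x`. -/
noncomputable def phi (ω x : ℝ) : ℝ := x * (1 - x ^ (-ω)) - ω * Real.log x

/-- `Θ*(u) = sup { ω ∈ [1,2] : φ_ω(min_i u_i) ≥ 0 }`. -/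
noncomputable def ThetaStar {n : ℕ} (u : Fin n → ℝ) : ℝ :=
  sSup {ω : ℝ | ω ∈ Set.Icc (1 : ℝ) 2 ∧ 0 ≤ phi ω (sInf (Set.range u))}

/-- `Θ(u) = min(max(1, Θ*(u) − δ), θ0)`. -/
noncomputable def Theta {n : ℕ} (θ0 δ : ℝ) (u : Fin n → ℝ) : ℝ :=
  min (max 1 (ThetaStar u - δ)) θ0

/-- A quantitative form of the second-order expansion of `φ_ω` at `1`, in the variable `log x`. -/
theorem phi_nonneg_of_abs_log_le {ω x : ℝ} (hω₁ : 1 ≤ ω) (hω₂ : ω ≤ 2) (hx : 0 < x)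
    (hlog : |Real.log x| ≤ ω * (2 - ω)) : 0 ≤ phi ω x := by
  have hphi : phi ω x =
      Real.exp (Real.log x) - Real.exp ((1 - ω) * Real.log x) - ω * Real.log x := by
    have h : Real.exp ((1 - ω) * Real.log x) = x * x ^ (-ω) := by
      rw [mul_comm, ← Real.rpow_def_of_pos hx, sub_eq_add_neg, Real.rpow_add hx, Real.rpow_one]
    rw [phi, h, Real.exp_log hx]
    ring
  rw [hphi]
  generalize Real.log x = t at hlog ⊢
  have ht : |t| ≤ 1 := hlog.trans (by nlinarith [sq_nonneg (ω - 1)])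
  have hcu : |(1 - ω) * t| ≤ |t| := by
    rw [abs_mul]
    exact mul_le_of_le_one_left (abs_nonneg t) (abs_le.2 ⟨by linarith, by linarith⟩)
  have h₁ := Real.exp_bound ht (n := 3) (by norm_num)
  have h₂ := Real.exp_bound (hcu.trans ht) (n := 3) (by norm_num)
  have hcube : |(1 - ω) * t| ^ 3 ≤ |t| ^ 3 := pow_le_pow_left₀ (abs_nonneg _) hcu 3
  have hmul : |t| ^ 3 ≤ ω * (2 - ω) * t ^ 2 := by
    rw [← sq_abs t, pow_succ']
    exact mul_le_mul_of_nonneg_right hlog (sq_nonneg _)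
  have hpos : 0 ≤ |t| ^ 3 := by positivity
  norm_num [Finset.sum_range_succ, Nat.factorial] at h₁ h₂
  have h₁' := (abs_le.1 h₁).1
  have h₂' := (abs_le.1 h₂).2
  rw [abs_mul] at hcube
  nlinarith

theorem le_ThetaStar {n : ℕ} {u : Fin n → ℝ} {ω : ℝ} (hω : ω ∈ Set.Icc (1 : ℝ) 2)
    (h : 0 ≤ phi ω (sInf (Set.range u))) : ω ≤ ThetaStar u :=
  le_csSup ⟨2, fun _ hy => hy.1.2⟩ ⟨hω, h⟩

theorem stmt_11 (n : ℕ) (hn : 0 < n)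
    (θ0 δ : ℝ) (hθ0 : θ0 ∈ Set.Ioo (1 : ℝ) 2) (hδ : 0 < δ) (hsum : θ0 + δ < 2) :
    ∃ ε > 0, ∀ u : Fin n → ℝ, (∀ i, 0 < u i) → (∀ i, |u i - 1| < ε) →
      Theta θ0 δ u = θ0 := by
  have h1 : 1 ≤ θ0 + δ := by linarith [hθ0.1]
  have hr : 0 < (θ0 + δ) * (2 - (θ0 + δ)) := mul_pos (by linarith) (by linarith)
  obtain ⟨ε, hε, hball⟩ :=
    Metric.continuousAt_iff.1 (Real.continuousAt_log one_ne_zero) _ hr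
  refine ⟨ε, hε, fun u hu hclose => ?_⟩
  have : Nonempty (Fin n) := ⟨⟨0, hn⟩⟩
  obtain ⟨i, hi⟩ := (Set.range_nonempty u).csInf_mem (Set.finite_range u)
  have hlog : |Real.log (u i)| < (θ0 + δ) * (2 - (θ0 + δ)) := by
    simpa [Real.dist_eq] using hball (x := u i) (by simpa [Real.dist_eq] using hclose i)
  have hle : θ0 + δ ≤ ThetaStar u := by
    refine le_ThetaStar ⟨h1, hsum.le⟩ ?_
    rw [← hi]
    exact phi_nonneg_of_abs_log_le h1 hsum.le (hu i) hlog.le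
  exact min_eq_right (le_max_of_le_right (by linarith))
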